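/- Let (M,·,1) be a monoid and let S be a naturally ordered ω-cocontinuous M-module. Then for every M-wGCL program C, the weakest liberal preweighting transformer wlp[C] is a well-defined ω-cocontinuous endofunction on the M-module 𝕎 of weightings over S; in particular, for a loop while(φ){C'} with wlp-characteristic function Ψ_f(X) = [¬φ]⋄f ⊕ [φ]⋄wlp[C'](X), the greatest fixed point defining wlp[while(φ){C'}](f) exists and equals the infimum ⨅_{i∈ℕ} Ψ_f^i(⊤) of the Kleene iterates from the greatest weighting ⊤. -/

import Mathlib

/-! ## Monoid modules, natural order, ω-(co)continuity -/

structure MonModule (M : Type) [Monoid M] (S : Type) where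
  add : S → S → S
  zero : S
  smul : M → S → S
  add_assoc : ∀ a b c : S, add (add a b) c = add a (add b c)
  add_comm : ∀ a b : S, add a b = add b a
  add_zero : ∀ a : S, add a zero = a
  smul_assoc : ∀ (u v : M) (a : S), smul (u * v) a = smul u (smul v a)
  smul_add : ∀ (u : M) (a b : S), smul u (add a b) = add (smul u a) (smul u b)
  one_smul : ∀ a : S, smul 1 a = a
  smul_zero : ∀ u : M, smul u zero = zero

namespace MonModule

variable {M S : Type} [Monoid M]

/-- The natural (pre)order: `a ⪯ b` iff `∃ c, a ⊕ c = b`. -/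
def le (mm : MonModule M S) (a b : S) : Prop := ∃ c : S, mm.add a c = b

/-- `S` is naturally ordered if the natural order is antisymmetric (hence a partial order). -/
def NaturallyOrdered (mm : MonModule M S) : Prop :=
  ∀ a b : S, mm.le a b → mm.le b a → a = b

/-- ω-chain (ascending). -/
def Chain (mm : MonModule M S) (s : ℕ → S) : Prop := ∀ n : ℕ, mm.le (s n) (s (n + 1))

/-- ω-descending chain. -/
def DChain (mm : MonModule M S) (s : ℕ → S) : Prop := ∀ n : ℕ, mm.le (s (n + 1)) (s n)

/-- `x` is the supremum (least upper bound) of `s` w.r.t. the natural order. -/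
def IsSup (mm : MonModule M S) (s : ℕ → S) (x : S) : Prop :=
  (∀ n : ℕ, mm.le (s n) x) ∧ ∀ y : S, (∀ n : ℕ, mm.le (s n) y) → mm.le x y

/-- `x` is the infimum (greatest lower bound) of `s` w.r.t. the natural order. -/
def IsInf (mm : MonModule M S) (s : ℕ → S) (x : S) : Prop :=
  (∀ n : ℕ, mm.le x (s n)) ∧ ∀ y : S, (∀ n : ℕ, mm.le y (s n)) → mm.le y x

end MonModule

/-- `S` is ω-continuous: suprema of ω-chains exist (with least element `𝟘`, which is
automatically least for the natural order), and `⊕`, `⊗` are ω-continuous. -/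
structure OmegaContinuous {M S : Type} [Monoid M] (mm : MonModule M S) : Prop where
  sup_exists : ∀ s : ℕ → S, mm.Chain s → ∃ x : S, mm.IsSup s x
  add_cont : ∀ (a : S) (s : ℕ → S) (x : S), mm.Chain s → mm.IsSup s x →
    mm.IsSup (fun n => mm.add a (s n)) (mm.add a x)
  smul_cont : ∀ (u : M) (s : ℕ → S) (x : S), mm.Chain s → mm.IsSup s x →
    mm.IsSup (fun n => mm.smul u (s n)) (mm.smul u x)

/-- `S` is ω-cocontinuous: a greatest element exists, infima of ω-descending chains exist,
and `⊕`, `⊗` are ω-cocontinuous. -/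
structure OmegaCocontinuous {M S : Type} [Monoid M] (mm : MonModule M S) : Prop where
  top_exists : ∃ t : S, ∀ a : S, mm.le a t
  inf_exists : ∀ s : ℕ → S, mm.DChain s → ∃ x : S, mm.IsInf s x
  add_cocont : ∀ (a : S) (s : ℕ → S) (x : S), mm.DChain s → mm.IsInf s x →
    mm.IsInf (fun n => mm.add a (s n)) (mm.add a x)
  smul_cocont : ∀ (u : M) (s : ℕ → S) (x : S), mm.DChain s → mm.IsInf s x →
    mm.IsInf (fun n => mm.smul u (s n)) (mm.smul u x)

def OmegaBicontinuous {M S : Type} [Monoid M] (mm : MonModule M S) : Prop :=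
  OmegaContinuous mm ∧ OmegaCocontinuous mm

/-! ## Weightings (pointwise lifting to `St → S`) -/

section Weightings

variable {M S St : Type} [Monoid M]

/-- Pointwise natural order on weightings. -/
def wle (mm : MonModule M S) (f g : St → S) : Prop := ∀ σ : St, mm.le (f σ) (g σ)

def WChain (mm : MonModule M S) (s : ℕ → St → S) : Prop := ∀ n : ℕ, wle mm (s n) (s (n + 1))

def WDChain (mm : MonModule M S) (s : ℕ → St → S) : Prop := ∀ n : ℕ, wle mm (s (n + 1)) (s n)

def WIsSup (mm : MonModule M S) (s : ℕ → St → S) (x : St → S) : Prop :=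
  (∀ n : ℕ, wle mm (s n) x) ∧ ∀ y : St → S, (∀ n : ℕ, wle mm (s n) y) → wle mm x y

def WIsInf (mm : MonModule M S) (s : ℕ → St → S) (x : St → S) : Prop :=
  (∀ n : ℕ, wle mm x (s n)) ∧ ∀ y : St → S, (∀ n : ℕ, wle mm y (s n)) → wle mm y x

end Weightings

/-! ## wGCL syntax -/

/-- wGCL programs over weights from `M` and program states from `St`:
assignments (as state transformations), sequencing, conditionals, nondeterministic
branching, weighting `⊙ a`, and loops. -/
inductive WGCL (M : Type) (St : Type) : Type
  | assign : (St → St) → WGCL M St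
  | seq : WGCL M St → WGCL M St → WGCL M St
  | ite : Set St → WGCL M St → WGCL M St → WGCL M St
  | branch : WGCL M St → WGCL M St → WGCL M St
  | weight : M → WGCL M St
  | wloop : Set St → WGCL M St → WGCL M St

section Transformers

variable {M S St : Type} [Monoid M]

/-- Iverson-bracket guarding `[φ] ⋄ f`. -/
noncomputable def iv (mm : MonModule M S) (φ : Set St) (f : St → S) : St → S :=
  fun σ => @ite _ (σ ∈ φ) (Classical.propDecidable _) (f σ) mm.zero

/-- Least fixed point of `Φ` w.r.t. the pointwise natural order (chosen by classical choice
if it exists; arbitrary otherwise). -/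
noncomputable def wlfp (mm : MonModule M S) (Φ : (St → S) → St → S) : St → S :=
  @dite _ (∃ x : St → S, Φ x = x ∧ ∀ y : St → S, Φ y = y → wle mm x y)
    (Classical.propDecidable _) (fun h => h.choose) (fun _ => fun _ => mm.zero)

/-- Greatest fixed point of `Φ` w.r.t. the pointwise natural order. -/
noncomputable def wgfp (mm : MonModule M S) (Φ : (St → S) → St → S) : St → S :=
  @dite _ (∃ x : St → S, Φ x = x ∧ ∀ y : St → S, Φ y = y → wle mm y x)
    (Classical.propDecidable _) (fun h => h.choose) (fun _ => fun _ => mm.zero)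

/-- Weakest preweighting transformer `wp`. -/
noncomputable def wp (mm : MonModule M S) : WGCL M St → (St → S) → St → S
  | WGCL.assign g => fun f σ => f (g σ)
  | WGCL.seq C₁ C₂ => fun f => wp mm C₁ (wp mm C₂ f)
  | WGCL.ite φ C₁ C₂ => fun f σ => mm.add (iv mm φ (wp mm C₁ f) σ) (iv mm φᶜ (wp mm C₂ f) σ)
  | WGCL.branch C₁ C₂ => fun f σ => mm.add (wp mm C₁ f σ) (wp mm C₂ f σ)
  | WGCL.weight a => fun f σ => mm.smul a (f σ)
  | WGCL.wloop φ C' => fun f =>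
      wlfp mm (fun X σ => mm.add (iv mm φᶜ f σ) (iv mm φ (wp mm C' X) σ))

/-- The `wp`-characteristic function `Φ_f(X) = [¬φ]⋄f ⊕ [φ]⋄wp[C'](X)` of `while(φ){C'}`. -/
noncomputable def charW (mm : MonModule M S) (φ : Set St) (C' : WGCL M St) (f : St → S)
    (X : St → S) : St → S :=
  fun σ => mm.add (iv mm φᶜ f σ) (iv mm φ (wp mm C' X) σ)

/-- Weakest liberal preweighting transformer `wlp`. -/
noncomputable def wlp (mm : MonModule M S) : WGCL M St → (St → S) → St → S
  | WGCL.assign g => fun f σ => f (g σ)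
  | WGCL.seq C₁ C₂ => fun f => wlp mm C₁ (wlp mm C₂ f)
  | WGCL.ite φ C₁ C₂ => fun f σ => mm.add (iv mm φ (wlp mm C₁ f) σ) (iv mm φᶜ (wlp mm C₂ f) σ)
  | WGCL.branch C₁ C₂ => fun f σ => mm.add (wlp mm C₁ f σ) (wlp mm C₂ f σ)
  | WGCL.weight a => fun f σ => mm.smul a (f σ)
  | WGCL.wloop φ C' => fun f =>
      wgfp mm (fun X σ => mm.add (iv mm φᶜ f σ) (iv mm φ (wlp mm C' X) σ))

/-- The `wlp`-characteristic function `Ψ_f(X) = [¬φ]⋄f ⊕ [φ]⋄wlp[C'](X)` of `while(φ){C'}`. -/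
noncomputable def charWlp (mm : MonModule M S) (φ : Set St) (C' : WGCL M St) (f : St → S)
    (X : St → S) : St → S :=
  fun σ => mm.add (iv mm φᶜ f σ) (iv mm φ (wlp mm C' X) σ)

end Transformers

/-! ## Operational semantics -/

/-- Configurations: `none` is a terminal configuration. -/
abbrev Conf (M St : Type) := Option (WGCL M St) × St

section Operational

variable {M St : Type} [Monoid M]

/-- Weighted small-step operational semantics: each transition carries a weight in `M`
(the weight `a` for executing `⊙ a`, and `1` otherwise). -/
inductive Step : Conf M St → M → Conf M St → Prop
  | assign (g : St → St) (σ : St) : Step (some (WGCL.assign g), σ) 1 (none, g σ)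
  | weight (a : M) (σ : St) : Step (some (WGCL.weight a), σ) a (none, σ)
  | seq_fin {C₁ : WGCL M St} {σ : St} {w : M} {σ' : St} (C₂ : WGCL M St) :
      Step (some C₁, σ) w (none, σ') → Step (some (WGCL.seq C₁ C₂), σ) w (some C₂, σ')
  | seq_step {C₁ : WGCL M St} {σ : St} {w : M} {C₁' : WGCL M St} {σ' : St} (C₂ : WGCL M St) :
      Step (some C₁, σ) w (some C₁', σ') →
      Step (some (WGCL.seq C₁ C₂), σ) w (some (WGCL.seq C₁' C₂), σ')
  | ite_left {φ : Set St} {σ : St} (C₁ C₂ : WGCL M St) :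
      σ ∈ φ → Step (some (WGCL.ite φ C₁ C₂), σ) 1 (some C₁, σ)
  | ite_right {φ : Set St} {σ : St} (C₁ C₂ : WGCL M St) :
      σ ∉ φ → Step (some (WGCL.ite φ C₁ C₂), σ) 1 (some C₂, σ)
  | branch_left (C₁ C₂ : WGCL M St) (σ : St) :
      Step (some (WGCL.branch C₁ C₂), σ) 1 (some C₁, σ)
  | branch_right (C₁ C₂ : WGCL M St) (σ : St) :
      Step (some (WGCL.branch C₁ C₂), σ) 1 (some C₂, σ)
  | loop_enter {φ : Set St} {σ : St} (C : WGCL M St) :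
      σ ∈ φ → Step (some (WGCL.wloop φ C), σ) 1 (some (WGCL.seq C (WGCL.wloop φ C)), σ)
  | loop_exit {φ : Set St} {σ : St} (C : WGCL M St) :
      σ ∉ φ → Step (some (WGCL.wloop φ C), σ) 1 (none, σ)

/-- A finite computation path from configuration `c`, recorded as the list of
(transition weight, successor configuration) pairs. -/
inductive Steps : Conf M St → List (M × Conf M St) → Prop
  | nil (c : Conf M St) : Steps c []
  | cons {c : Conf M St} {w : M} {c' : Conf M St} {l : List (M × Conf M St)} :
      Step c w c' → Steps c' l → Steps c ((w, c') :: l)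

/-- Weight of a computation path: the ordered product of its transition weights. -/
def pathWeight (l : List (M × Conf M St)) : M := (l.map Prod.fst).prod

/-- Final state of a (nonempty) computation path; `σ` for the empty path. -/
def lastState (σ : St) (l : List (M × Conf M St)) : St :=
  (l.getLastD ((1 : M), ((none : Option (WGCL M St)), σ))).2.2

/-- A terminating computation path from `c`: a finite path ending in a terminal
configuration. -/
def TermPath (c : Conf M St) (l : List (M × Conf M St)) : Prop :=
  Steps c l ∧ ∃ p : M × Conf M St, l.getLast? = some p ∧ p.2.1 = (none : Option (WGCL M St))

/-- There is an infinite computation path starting in `c`. -/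
def InfinitePathFrom (c : Conf M St) : Prop :=
  ∃ π : ℕ → Conf M St, π 0 = c ∧ ∀ n : ℕ, ∃ w : M, Step (π n) w (π (n + 1))

end Operational

/-! ## Countable module sums as suprema of finite partial sums -/

section Sums

variable {M S : Type} [Monoid M]

/-- Finite sum of `g` over the elements of a list. -/
def finListSum (mm : MonModule M S) {ι : Type} (g : ι → S) : List ι → S
  | [] => mm.zero
  | i :: t => mm.add (g i) (finListSum mm g t)

/-- `x` is the (countable) module sum `⨁_{i ∈ T} g i`, i.e. the least upper bound
of all finite partial sums over duplicate-free lists of elements of `T`. -/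
def IsSumOver (mm : MonModule M S) {ι : Type} (T : Set ι) (g : ι → S) (x : S) : Prop :=
  (∀ l : List ι, l.Nodup → (∀ i ∈ l, i ∈ T) → mm.le (finListSum mm g l) x) ∧
  ∀ y : S, (∀ l : List ι, l.Nodup → (∀ i ∈ l, i ∈ T) → mm.le (finListSum mm g l) y) → mm.le x y

end Sums

namespace MonModule

variable {M S : Type} [Monoid M] {mm : MonModule M S}

theorem le_refl (a : S) : mm.le a a := ⟨mm.zero, mm.add_zero a⟩

theorem le_trans {a b c : S} (hab : mm.le a b) (hbc : mm.le b c) : mm.le a c := by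
  obtain ⟨u, rfl⟩ := hab
  obtain ⟨v, rfl⟩ := hbc
  exact ⟨mm.add u v, (mm.add_assoc a u v).symm⟩

theorem add_le_add_left {a b : S} (c : S) (h : mm.le a b) :
    mm.le (mm.add c a) (mm.add c b) := by
  obtain ⟨u, rfl⟩ := h
  exact ⟨u, mm.add_assoc c a u⟩

theorem add_le_add {a b c d : S} (hab : mm.le a b) (hcd : mm.le c d) :
    mm.le (mm.add a c) (mm.add b d) := by
  refine le_trans (add_le_add_left a hcd) ?_
  rw [mm.add_comm a d, mm.add_comm b d]
  exact add_le_add_left d hab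

theorem smul_le_smul {a b : S} (u : M) (h : mm.le a b) :
    mm.le (mm.smul u a) (mm.smul u b) := by
  obtain ⟨c, rfl⟩ := h
  exact ⟨mm.smul u c, (mm.smul_add u a c).symm⟩

theorem DChain.le_of_le {s : ℕ → S} (hs : mm.DChain s) {m n : ℕ} (h : m ≤ n) :
    mm.le (s n) (s m) := by
  induction n, h using Nat.le_induction with
  | base => exact le_refl _
  | succ n _ ih => exact le_trans (hs n) ih

theorem isInf_const (a : S) : mm.IsInf (fun _ => a) a :=
  ⟨fun _ => le_refl a, fun _ h => h 0⟩

theorem IsInf.add (hc : OmegaCocontinuous mm) {s t : ℕ → S} {a b : S} (hs : mm.DChain s)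
    (ht : mm.DChain t) (ha : mm.IsInf s a) (hb : mm.IsInf t b) :
    mm.IsInf (fun n => mm.add (s n) (t n)) (mm.add a b) := by
  refine ⟨fun n => add_le_add (ha.1 n) (hb.1 n), fun y hy => ?_⟩
  have hfst : ∀ n, mm.le y (mm.add (s n) b) := fun n =>
    (hc.add_cocont (s n) t b ht hb).2 y fun m =>
      le_trans (hy (max n m)) (add_le_add (hs.le_of_le (le_max_left n m))
        (ht.le_of_le (le_max_right n m)))
  rw [mm.add_comm a b]
  refine (hc.add_cocont b s a hs ha).2 y fun n => ?_
  simpa only [mm.add_comm b (s n)] using hfst n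

end MonModule

section Weightings

variable {M S St : Type} [Monoid M] {mm : MonModule M S}

theorem wle_refl (f : St → S) : wle mm f f := fun _ => MonModule.le_refl _

theorem wle_trans {f g h : St → S} (hfg : wle mm f g) (hgh : wle mm g h) : wle mm f h :=
  fun σ => MonModule.le_trans (hfg σ) (hgh σ)

theorem wle_antisymm (hord : mm.NaturallyOrdered) {f g : St → S} (hfg : wle mm f g)
    (hgf : wle mm g f) : f = g :=
  funext fun σ => hord _ _ (hfg σ) (hgf σ)

theorem wIsInf_iff {s : ℕ → St → S} {x : St → S} :
    WIsInf mm s x ↔ ∀ σ, mm.IsInf (fun n => s n σ) (x σ) := by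
  classical
  refine ⟨fun h σ => ⟨fun n => h.1 n σ, fun y hy => ?_⟩, fun h =>
    ⟨fun n σ => (h σ).1 n, fun y hy σ => (h σ).2 _ fun n => hy n σ⟩⟩
  have hle : wle mm (Function.update x σ y) x := by
    refine h.2 _ fun n τ => ?_
    rcases eq_or_ne τ σ with rfl | hne
    · simpa using hy n
    · simpa [hne] using h.1 n τ
  simpa using hle σ

theorem WIsInf.unique (hord : mm.NaturallyOrdered) {s : ℕ → St → S} {x y : St → S}
    (hx : WIsInf mm s x) (hy : WIsInf mm s y) : x = y :=
  wle_antisymm hord (hy.2 x hx.1) (hx.2 y hy.1)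

theorem wIsInf_shift {s : ℕ → St → S} {x : St → S} (hs : WDChain mm s) (hx : WIsInf mm s x) :
    WIsInf mm (fun n => s (n + 1)) x :=
  ⟨fun n => hx.1 (n + 1), fun y hy => hx.2 y fun n => wle_trans (hy n) (hs n)⟩

theorem OmegaCocontinuous.exists_wIsInf (hc : OmegaCocontinuous mm) {s : ℕ → St → S}
    (hs : WDChain mm s) : ∃ x, WIsInf mm s x := by
  choose x hx using fun σ => hc.inf_exists (fun n => s n σ) fun n => hs n σ
  exact ⟨x, wIsInf_iff.2 hx⟩

theorem wgfp_eq (hord : mm.NaturallyOrdered) {F : (St → S) → St → S} {x : St → S}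
    (hx : F x = x) (hmax : ∀ y, F y = y → wle mm y x) : wgfp mm F = x := by
  have h : ∃ x, F x = x ∧ ∀ y, F y = y → wle mm y x := ⟨x, hx, hmax⟩
  rw [wgfp, dif_pos h]
  exact wle_antisymm hord (hmax _ h.choose_spec.1) (h.choose_spec.2 x hx)

/-- Monotone transformers of weightings that preserve infima of ω-descending chains. -/
def WCocontinuous (mm : MonModule M S) (F : (St → S) → St → S) : Prop :=
  (∀ f g : St → S, wle mm f g → wle mm (F f) (F g)) ∧
  ∀ (s : ℕ → St → S) (x : St → S), WDChain mm s → WIsInf mm s x →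
    WIsInf mm (fun n => F (s n)) (F x)

namespace WCocontinuous

variable {F G : (St → S) → St → S}

theorem map_wDChain (hF : WCocontinuous mm F) {s : ℕ → St → S} (hs : WDChain mm s) :
    WDChain mm fun n => F (s n) :=
  fun n => hF.1 _ _ (hs n)

theorem const (c : St → S) : WCocontinuous mm fun _ : St → S => c :=
  ⟨fun _ _ _ => wle_refl c, fun _ _ _ _ => ⟨fun _ => wle_refl c, fun _ h => h 0⟩⟩

theorem comp (hF : WCocontinuous mm F) (hG : WCocontinuous mm G) :
    WCocontinuous mm fun f => F (G f) :=
  ⟨fun _ _ h => hF.1 _ _ (hG.1 _ _ h),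
    fun s x hs hx => hF.2 _ _ (hG.map_wDChain hs) (hG.2 s x hs hx)⟩

theorem assign (g : St → St) : WCocontinuous mm fun (f : St → S) σ => f (g σ) :=
  ⟨fun _ _ h σ => h (g σ),
    fun _ _ _ hx => wIsInf_iff.2 fun σ => wIsInf_iff.1 hx (g σ)⟩

theorem smul (hc : OmegaCocontinuous mm) (u : M) :
    WCocontinuous mm fun (f : St → S) σ => mm.smul u (f σ) :=
  ⟨fun _ _ h σ => MonModule.smul_le_smul u (h σ), fun s _ hs hx => wIsInf_iff.2 fun σ =>
    hc.smul_cocont u (fun n => s n σ) _ (fun n => hs n σ) (wIsInf_iff.1 hx σ)⟩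

theorem add (hc : OmegaCocontinuous mm) (hF : WCocontinuous mm F) (hG : WCocontinuous mm G) :
    WCocontinuous mm fun f σ => mm.add (F f σ) (G f σ) :=
  ⟨fun _ _ h σ => MonModule.add_le_add (hF.1 _ _ h σ) (hG.1 _ _ h σ),
    fun s x hs hx => wIsInf_iff.2 fun σ =>
      MonModule.IsInf.add hc (fun n => hF.map_wDChain hs n σ) (fun n => hG.map_wDChain hs n σ)
        (wIsInf_iff.1 (hF.2 s x hs hx) σ) (wIsInf_iff.1 (hG.2 s x hs hx) σ)⟩

theorem iv (φ : Set St) : WCocontinuous mm fun f : St → S => iv mm φ f := by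
  refine ⟨fun f g h σ => ?_, fun s x _ hx => wIsInf_iff.2 fun σ => ?_⟩
  · by_cases hσ : σ ∈ φ
    · simpa [_root_.iv, hσ] using h σ
    · simpa [_root_.iv, hσ] using MonModule.le_refl mm.zero
  · by_cases hσ : σ ∈ φ
    · simpa [_root_.iv, hσ] using wIsInf_iff.1 hx σ
    · simpa [_root_.iv, hσ] using MonModule.isInf_const mm.zero

end WCocontinuous

/-! ### Kleene iteration from the greatest weighting -/

theorem wDChain_iterate {F : (St → S) → St → S} (hF : ∀ f g, wle mm f g → wle mm (F f) (F g))
    {T : St → S} (hT : ∀ g, wle mm g T) : WDChain mm fun i => F^[i] T := by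
  intro i
  induction i with
  | zero => exact hT _
  | succ i ih =>
    simp only [Function.iterate_succ_apply'] at ih ⊢
    exact hF _ _ ih

theorem WCocontinuous.isGreatest_fixedPoint (hord : mm.NaturallyOrdered)
    {F : (St → S) → St → S} (hF : WCocontinuous mm F) {T x : St → S}
    (hT : ∀ g, wle mm g T) (hx : WIsInf mm (fun i => F^[i] T) x) :
    F x = x ∧ ∀ y, F y = y → wle mm y x := by
  have hchain := wDChain_iterate hF.1 hT
  constructor
  · refine WIsInf.unique hord (hF.2 _ _ hchain hx) ?_
    simpa only [Function.iterate_succ_apply'] using wIsInf_shift hchain hx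
  · refine fun y hy => hx.2 y fun i => ?_
    induction i with
    | zero => exact hT y
    | succ i ih =>
      simp only [Function.iterate_succ_apply']
      rw [← hy]
      exact hF.1 _ _ ih

theorem WCocontinuous.wIsInf_iterate_wgfp (hord : mm.NaturallyOrdered)
    (hc : OmegaCocontinuous mm) {F : (St → S) → St → S} (hF : WCocontinuous mm F)
    {T : St → S} (hT : ∀ g, wle mm g T) : WIsInf mm (fun i => F^[i] T) (wgfp mm F) := by
  obtain ⟨x, hx⟩ := hc.exists_wIsInf (wDChain_iterate hF.1 hT)
  obtain ⟨hfix, hmax⟩ := hF.isGreatest_fixedPoint hord hT hx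
  rwa [wgfp_eq hord hfix hmax]

theorem OmegaCocontinuous.exists_wtop (hc : OmegaCocontinuous mm) :
    ∃ T : St → S, ∀ g, wle mm g T := by
  obtain ⟨t, ht⟩ := hc.top_exists
  exact ⟨fun _ => t, fun g σ => ht (g σ)⟩

/-- A pointwise infimum of cocontinuous transformers is cocontinuous. -/
theorem WCocontinuous.of_wIsInf {F : ℕ → (St → S) → St → S} {G : (St → S) → St → S}
    (hF : ∀ i, WCocontinuous mm (F i)) (hG : ∀ f, WIsInf mm (fun i => F i f) (G f)) :
    WCocontinuous mm G := by
  have hmono : ∀ f g, wle mm f g → wle mm (G f) (G g) := fun f g h =>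
    (hG g).2 _ fun i => wle_trans ((hG f).1 i) ((hF i).1 f g h)
  refine ⟨hmono, fun s x hs hx => ⟨fun n => hmono _ _ (hx.1 n), fun y hy => ?_⟩⟩
  exact (hG x).2 y fun i => ((hF i).2 s x hs hx).2 y fun n => wle_trans (hy n) ((hG (s n)).1 i)

variable {φ : Set St} {C : WGCL M St}

theorem WCocontinuous.charWlp (hc : OmegaCocontinuous mm) (hC : WCocontinuous mm (wlp mm C))
    (f : St → S) : WCocontinuous mm (charWlp mm φ C f) :=
  .add hc (.const _) ((WCocontinuous.iv φ).comp hC)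

theorem WCocontinuous.charWlp_iterate (hc : OmegaCocontinuous mm)
    (hC : WCocontinuous mm (wlp mm C)) (T : St → S) (i : ℕ) :
    WCocontinuous mm fun f => (_root_.charWlp mm φ C f)^[i] T := by
  induction i with
  | zero => exact .const T
  | succ i ih =>
    simp only [Function.iterate_succ_apply']
    exact .add hc (.iv φᶜ) ((WCocontinuous.iv φ).comp (hC.comp ih))

theorem wlp_wloop (f : St → S) :
    wlp mm (WGCL.wloop φ C) f = wgfp mm (charWlp mm φ C f) := by
  rw [wlp]
  rfl

theorem wCocontinuous_wlp (hord : mm.NaturallyOrdered) (hc : OmegaCocontinuous mm)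
    (C : WGCL M St) : WCocontinuous mm (wlp mm C) := by
  induction C with
  | assign g => simpa only [wlp] using .assign g
  | seq C₁ C₂ ih₁ ih₂ => simpa only [wlp] using ih₁.comp ih₂
  | ite φ C₁ C₂ ih₁ ih₂ =>
    simpa only [wlp] using
      .add hc ((WCocontinuous.iv φ).comp ih₁) ((WCocontinuous.iv φᶜ).comp ih₂)
  | branch C₁ C₂ ih₁ ih₂ => simpa only [wlp] using .add hc ih₁ ih₂
  | weight a => simpa only [wlp] using .smul hc a
  | wloop φ C ih =>
    obtain ⟨T, hT⟩ := hc.exists_wtop (St := St)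
    refine .of_wIsInf (fun i => .charWlp_iterate (φ := φ) hc ih T i) fun f => ?_
    rw [wlp_wloop]
    exact (ih.charWlp hc f).wIsInf_iterate_wgfp hord hc hT

end Weightings

/-- **Well-definedness of wlp**: for a naturally ordered ω-cocontinuous `M`-module `S`,
`wlp[C]` is an ω-cocontinuous endofunction on the module of weightings (monotone and
preserving infima of ω-descending chains), and for loops the greatest fixed point of the
characteristic function exists, is attained by `wlp[while(φ){C'}](f)`, and equals the
infimum of the Kleene iterates from the greatest weighting `⊤`. -/
theorem wlp_well_defined (M S St : Type) [Monoid M] [Countable St] (mm : MonModule M S)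
    (hord : mm.NaturallyOrdered) (hcocont : OmegaCocontinuous mm) :
    (∀ C : WGCL M St,
      (∀ f g : St → S, wle mm f g → wle mm (wlp mm C f) (wlp mm C g)) ∧
      (∀ (s : ℕ → St → S) (x : St → S), WDChain mm s → WIsInf mm s x →
        WIsInf mm (fun n => wlp mm C (s n)) (wlp mm C x)))
    ∧
    (∀ (φ : Set St) (C' : WGCL M St) (f : St → S),
      (charWlp mm φ C' f (wlp mm (WGCL.wloop φ C') f) = wlp mm (WGCL.wloop φ C') f ∧
        ∀ y : St → S, charWlp mm φ C' f y = y → wle mm y (wlp mm (WGCL.wloop φ C') f))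
      ∧
      ∀ T : St → S, (∀ (g : St → S), wle mm g T) →
        WIsInf mm (fun i => (charWlp mm φ C' f)^[i] T) (wlp mm (WGCL.wloop φ C') f)) := by
  refine ⟨wCocontinuous_wlp hord hcocont, fun φ C' f => ?_⟩
  have hΨ := (wCocontinuous_wlp hord hcocont C').charWlp (φ := φ) hcocont f
  rw [wlp_wloop]
  obtain ⟨T, hT⟩ := hcocont.exists_wtop (St := St)
  exact ⟨hΨ.isGreatest_fixedPoint hord hT (hΨ.wIsInf_iterate_wgfp hord hcocont hT),
    fun _ hT' => hΨ.wIsInf_iterate_wgfp hord hcocont hT'⟩
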